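/- arXiv:1410.8678 — 7 statements merged into one kernel-verified Lean document; each statement's English description precedes it below -/
import Mathlib

section
/- Let 𝓕 : ℝ^k×ℝⁿ×ℝ → ℝ be a C^∞ function in the variables (q,x,t) with 𝓕(0) = 0 and ∂𝓕/∂qᵢ(0) = 0 for i = 1,…,k, and suppose the total derivative at the origin of Δ*𝓕 = (𝓕, ∂𝓕/∂q₁, …, ∂𝓕/∂q_k) : ℝ^k×ℝⁿ×ℝ → ℝ×ℝ^k is surjective (𝓕 is a big Morse family of hypersurfaces at the origin). Then the following are equivalent: (a) the linear functional (u,v,s) ↦ s on ℝ^k×ℝⁿ×ℝ is not identically zero on ker D(Δ*𝓕)(0), i.e. the projection (q,x,t) ↦ t restricted to the submanifold Σ*(𝓕) = (Δ*𝓕)⁻¹(0) is a submersion at the origin; (b) the total derivative at the origin of the map (q,x) ↦ (𝓕(q,x,0), ∂𝓕/∂q₁(q,x,0), …, ∂𝓕/∂q_k(q,x,0)) : ℝ^k×ℝⁿ → ℝ×ℝ^k is surjective. -/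
/-- `Δ*𝓕 = (𝓕, ∂𝓕/∂q₁, …, ∂𝓕/∂q_k)` for a big family `𝓕(q, x, t)`. -/
noncomputable def bigDeltaStar {k n : ℕ} (𝓕 : (Fin k → ℝ) × (Fin n → ℝ) × ℝ → ℝ) :
    (Fin k → ℝ) × (Fin n → ℝ) × ℝ → ℝ × (Fin k → ℝ) :=
  fun z => (𝓕 z, fun i => fderiv ℝ 𝓕 z (Pi.single i 1, 0, 0))

/-- For a surjective linear map `L` on `A × B × K`, the last coordinate is nonzero somewhere on
`ker L` if and only if the restriction of `L` to the hyperplane where it vanishes is surjective. -/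
theorem exists_ker_ne_zero_iff_surjective_restrict {K A B F : Type*} [Field K]
    [AddCommGroup A] [Module K A] [AddCommGroup B] [Module K B] [AddCommGroup F] [Module K F]
    (L : A × B × K →ₗ[K] F) (hL : Function.Surjective L) :
    (∃ z, L z = 0 ∧ z.2.2 ≠ 0) ↔ Function.Surjective fun v : A × B => L (v.1, v.2, 0) := by
  constructor
  · rintro ⟨z, hz, ht⟩ y
    obtain ⟨w, rfl⟩ := hL y
    let w' := w - (w.2.2 / z.2.2) • z
    have hw' : L w' = L w := by simp [w', hz]
    have ht' : w'.2.2 = 0 := by simp [w', ht]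
    refine ⟨(w'.1, w'.2.1), ?_⟩
    rw [← hw']
    exact congrArg L (Prod.ext rfl (Prod.ext rfl ht'.symm))
  · intro h
    obtain ⟨v, hv⟩ := h (L (0, 0, 1))
    exact ⟨(0, 0, 1) - (v.1, v.2, 0), by rw [map_sub, sub_eq_zero]; exact hv.symm, by simp⟩

/-- `Δ*𝓕` is smooth when `𝓕` is. -/
theorem contDiff_bigDeltaStar {k n : ℕ} {𝓕 : (Fin k → ℝ) × (Fin n → ℝ) × ℝ → ℝ}
    (h𝓕 : ContDiff ℝ (⊤ : ℕ∞) 𝓕) : ContDiff ℝ (⊤ : ℕ∞) (bigDeltaStar 𝓕) :=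
  h𝓕.prodMk <| contDiff_pi.2 fun _ =>
    (h𝓕.fderiv_right (m := (⊤ : ℕ∞)) (by simp)).clm_apply contDiff_const

/-- Proposition 4.2: for a big Morse family of hypersurfaces `𝓕` at the origin, the
restriction of `(q, x, t) ↦ t` to `Σ*(𝓕)` is a submersion at the origin (i.e. the
last coordinate is not identically zero on `ker D(Δ*𝓕)(0)`) if and only if the map
`(q, x) ↦ Δ*𝓕(q, x, 0)` has surjective derivative at the origin, i.e. `𝓕` is
non-degenerate. -/
theorem stmt_3 {k n : ℕ} (𝓕 : (Fin k → ℝ) × (Fin n → ℝ) × ℝ → ℝ)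
    (h𝓕 : ContDiff ℝ (⊤ : ℕ∞) 𝓕)
    (h0 : 𝓕 0 = 0)
    (hq : ∀ i : Fin k, fderiv ℝ 𝓕 0 (Pi.single i 1, 0, 0) = 0)
    (hsurj : Function.Surjective ⇑(fderiv ℝ (bigDeltaStar 𝓕) 0)) :
    ((∃ z : (Fin k → ℝ) × (Fin n → ℝ) × ℝ,
        fderiv ℝ (bigDeltaStar 𝓕) 0 z = 0 ∧ z.2.2 ≠ 0)
      ↔ Function.Surjective
          ⇑(fderiv ℝ (fun qx : (Fin k → ℝ) × (Fin n → ℝ) =>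
              bigDeltaStar 𝓕 (qx.1, qx.2, 0)) 0)) := by
  have hd : DifferentiableAt ℝ (bigDeltaStar 𝓕) 0 :=
    (contDiff_bigDeltaStar h𝓕).contDiffAt.differentiableAt (by simp)
  have hfun : ⇑(fderiv ℝ (fun qx : (Fin k → ℝ) × (Fin n → ℝ) =>
      bigDeltaStar 𝓕 (qx.1, qx.2, 0)) 0) =
      fun v => fderiv ℝ (bigDeltaStar 𝓕) 0 (v.1, v.2, 0) := by
    let ι : (Fin k → ℝ) × (Fin n → ℝ) →L[ℝ] (Fin k → ℝ) × (Fin n → ℝ) × ℝ :=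
      (ContinuousLinearMap.fst ℝ _ _).prod ((ContinuousLinearMap.snd ℝ _ _).prod 0)
    have hι : HasFDerivAt ι ι 0 := ι.hasFDerivAt
    have hd' : HasFDerivAt (bigDeltaStar 𝓕) (fderiv ℝ (bigDeltaStar 𝓕) 0) (ι 0) := by
      rw [map_zero]
      exact hd.hasFDerivAt
    have hcomp : fderiv ℝ (fun qx : (Fin k → ℝ) × (Fin n → ℝ) =>
        bigDeltaStar 𝓕 (qx.1, qx.2, 0)) 0 = (fderiv ℝ (bigDeltaStar 𝓕) 0).comp ι :=
      (hd'.comp 0 hι).fderiv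
    rw [hcomp]
    rfl
  rw [hfun]
  exact exists_ker_ne_zero_iff_surjective_restrict
    (fderiv ℝ (bigDeltaStar 𝓕) 0).toLinearMap hsurj
end

section
/- Let F : ℝ^k×ℝⁿ → ℝ and λ : ℝ^k×ℝⁿ×ℝ → ℝ be C^∞ functions with F(0,0) = 0, ∂F/∂qᵢ(0,0) = 0 for i = 1,…,k, and λ(0,0,0) ≠ 0, and define 𝓕(q,x,t) = λ(q,x,t)·(F(q,x) − t). Then the total derivative at the origin of Δ*𝓕 = (𝓕, ∂𝓕/∂q₁, …, ∂𝓕/∂q_k) : ℝ^k×ℝⁿ×ℝ → ℝ×ℝ^k is surjective if and only if the total derivative at the origin of ΔF = (∂F/∂q₁, …, ∂F/∂q_k) : ℝ^k×ℝⁿ → ℝ^k is surjective. Moreover ∂𝓕/∂t(0,0,0) = −λ(0,0,0) ≠ 0. -/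
/-- `ΔF = (∂F/∂q₁, …, ∂F/∂q_k)` for a family `F(q, x)`. -/
noncomputable def smallDelta {k n : ℕ} (F : (Fin k → ℝ) × (Fin n → ℝ) → ℝ) :
    (Fin k → ℝ) × (Fin n → ℝ) → (Fin k → ℝ) :=
  fun w => fun i => fderiv ℝ F w (Pi.single i 1, 0)

open ContinuousLinearMap in
/-- The derivative of `F(q, x) − t` as a function of `(q, x, t)`. -/
theorem hasFDerivAt_graph {k n : ℕ} {F : (Fin k → ℝ) × (Fin n → ℝ) → ℝ}
    (hF : Differentiable ℝ F) (z : (Fin k → ℝ) × (Fin n → ℝ) × ℝ) :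
    ∃ G' : ((Fin k → ℝ) × (Fin n → ℝ) × ℝ) →L[ℝ] ℝ,
      HasFDerivAt (fun z : (Fin k → ℝ) × (Fin n → ℝ) × ℝ => F (z.1, z.2.1) - z.2.2) G' z ∧
      ∀ w, G' w = fderiv ℝ F (z.1, z.2.1) (w.1, w.2.1) - w.2.2 := by
  let P : ((Fin k → ℝ) × (Fin n → ℝ) × ℝ) →L[ℝ] (Fin k → ℝ) × (Fin n → ℝ) :=
    (fst ℝ _ _).prod ((fst ℝ _ _).comp (snd ℝ _ _))
  let T : ((Fin k → ℝ) × (Fin n → ℝ) × ℝ) →L[ℝ] ℝ := (snd ℝ _ _).comp (snd ℝ _ _)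
  exact ⟨(fderiv ℝ F (P z)).comp P - T,
    ((hF (P z)).hasFDerivAt.comp z P.hasFDerivAt).sub T.hasFDerivAt, fun w => rfl⟩

/-- The product rule for `λ(q, x, t)·(F(q, x) − t)`. -/
theorem fderiv_mul_graph_apply {k n : ℕ} {F : (Fin k → ℝ) × (Fin n → ℝ) → ℝ}
    {lam : (Fin k → ℝ) × (Fin n → ℝ) × ℝ → ℝ}
    (hF : Differentiable ℝ F) (hlam : Differentiable ℝ lam)
    (z w : (Fin k → ℝ) × (Fin n → ℝ) × ℝ) :
    fderiv ℝ (fun z => lam z * (F (z.1, z.2.1) - z.2.2)) z w =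
      lam z * (fderiv ℝ F (z.1, z.2.1) (w.1, w.2.1) - w.2.2) +
        (F (z.1, z.2.1) - z.2.2) * fderiv ℝ lam z w := by
  obtain ⟨G', hG, hG'⟩ := hasFDerivAt_graph hF z
  have h := (hlam z).hasFDerivAt.fun_mul hG
  rw [h.fderiv]
  simp [hG']

open ContinuousLinearMap in
/-- The derivative at the origin of `Δ*𝓕` for `𝓕 = λ·(F − t)`, in terms of that of `ΔF`. -/
theorem fderiv_bigDeltaStar_apply {k n : ℕ} {F : (Fin k → ℝ) × (Fin n → ℝ) → ℝ}
    {lam : (Fin k → ℝ) × (Fin n → ℝ) × ℝ → ℝ}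
    (hF : ContDiff ℝ 2 F) (hlam : ContDiff ℝ 2 lam) (hF0 : F 0 = 0)
    (hFq : ∀ i : Fin k, fderiv ℝ F 0 (Pi.single i 1, 0) = 0)
    (w : (Fin k → ℝ) × (Fin n → ℝ) × ℝ) :
    fderiv ℝ (bigDeltaStar fun z => lam z * (F (z.1, z.2.1) - z.2.2)) 0 w =
      (lam 0 * (fderiv ℝ F 0 (w.1, w.2.1) - w.2.2),
        lam 0 • fderiv ℝ (smallDelta F) 0 (w.1, w.2.1) +
          (fderiv ℝ F 0 (w.1, w.2.1) - w.2.2) •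
            fun i => fderiv ℝ lam 0 (Pi.single i 1, 0, 0)) := by
  have dF : Differentiable ℝ F := hF.differentiable (by norm_num)
  have dlam : Differentiable ℝ lam := hlam.differentiable (by norm_num)
  have dF' : Differentiable ℝ (fderiv ℝ F) :=
    (hF.fderiv_right (m := 1) (by norm_num)).differentiable (by norm_num)
  have dlam' : Differentiable ℝ (fderiv ℝ lam) :=
    (hlam.fderiv_right (m := 1) (by norm_num)).differentiable (by norm_num)
  let P : ((Fin k → ℝ) × (Fin n → ℝ) × ℝ) →L[ℝ] (Fin k → ℝ) × (Fin n → ℝ) :=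
    (fst ℝ _ _).prod ((fst ℝ _ _).comp (snd ℝ _ _))
  obtain ⟨G', hG, hG'⟩ := hasFDerivAt_graph dF (0 : (Fin k → ℝ) × (Fin n → ℝ) × ℝ)
  have hS : HasFDerivAt (smallDelta F) (fderiv ℝ (smallDelta F) 0) 0 := by
    refine DifferentiableAt.hasFDerivAt (differentiableAt_pi.2 fun i => ?_)
    exact (dF' 0).clm_apply (differentiableAt_const _)
  have hSP : HasFDerivAt (fun z => smallDelta F (P z)) ((fderiv ℝ (smallDelta F) 0).comp P) 0 :=
    HasFDerivAt.comp (g := smallDelta F) 0 (by rwa [map_zero]) P.hasFDerivAt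
  have hb : ∀ i : Fin k, HasFDerivAt (fun z => fderiv ℝ lam z (Pi.single i 1, 0, 0))
      (fderiv ℝ (fun z => fderiv ℝ lam z (Pi.single i 1, 0, 0)) 0) 0 := fun i =>
    ((dlam' 0).clm_apply (differentiableAt_const _)).hasFDerivAt
  have hΔ : bigDeltaStar (fun z => lam z * (F (z.1, z.2.1) - z.2.2)) = fun z =>
      (lam z * (F (z.1, z.2.1) - z.2.2), fun i => lam z * smallDelta F (P z) i +
        (F (z.1, z.2.1) - z.2.2) * fderiv ℝ lam z (Pi.single i 1, 0, 0)) := by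
    funext z
    simp only [bigDeltaStar, fderiv_mul_graph_apply dF dlam, sub_zero]
    rfl
  have h := ((dlam 0).hasFDerivAt.fun_mul hG).prodMk (hasFDerivAt_pi.2 fun i : Fin k =>
    ((dlam 0).hasFDerivAt.fun_mul (hasFDerivAt_pi'.1 hSP i)).fun_add (hG.fun_mul (hb i)))
  have hS0 : ∀ i, smallDelta F 0 i = 0 := hFq
  rw [hΔ, h.fderiv]
  ext i
  · simp [hG', Prod.mk_zero_zero, hF0]
  · simp [hG', Prod.mk_zero_zero, hF0, hS0, P, mul_comm]

/-- Proposition 4.4: for `𝓕(q,x,t) = λ(q,x,t)·(F(q,x) − t)` with `λ(0) ≠ 0`,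
`F(0,0) = 0` and `∂F/∂qᵢ(0,0) = 0`, the derivative at the origin of `Δ*𝓕` is
surjective iff the derivative at the origin of `ΔF` is surjective; moreover
`∂𝓕/∂t(0) = −λ(0) ≠ 0`. -/
theorem stmt_4 {k n : ℕ} (F : (Fin k → ℝ) × (Fin n → ℝ) → ℝ)
    (lam : (Fin k → ℝ) × (Fin n → ℝ) × ℝ → ℝ)
    (hF : ContDiff ℝ (⊤ : ℕ∞) F) (hlam : ContDiff ℝ (⊤ : ℕ∞) lam)
    (hF0 : F 0 = 0)
    (hFq : ∀ i : Fin k, fderiv ℝ F 0 (Pi.single i 1, 0) = 0)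
    (hlam0 : lam 0 ≠ 0)
    (𝓕 : (Fin k → ℝ) × (Fin n → ℝ) × ℝ → ℝ)
    (h𝓕 : ∀ z, 𝓕 z = lam z * (F (z.1, z.2.1) - z.2.2)) :
    (Function.Surjective ⇑(fderiv ℝ (bigDeltaStar 𝓕) 0)
      ↔ Function.Surjective ⇑(fderiv ℝ (smallDelta F) 0)) ∧
    fderiv ℝ 𝓕 0 (0, 0, 1) = - lam 0 ∧ fderiv ℝ 𝓕 0 (0, 0, 1) ≠ 0 := by
  obtain rfl : 𝓕 = fun z => lam z * (F (z.1, z.2.1) - z.2.2) := funext h𝓕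
  have hF2 : ContDiff ℝ 2 F := contDiff_infty.1 hF 2
  have hlam2 : ContDiff ℝ 2 lam := contDiff_infty.1 hlam 2
  have ht : fderiv ℝ (fun z => lam z * (F (z.1, z.2.1) - z.2.2)) 0 (0, 0, 1) = -lam 0 := by
    rw [fderiv_mul_graph_apply (hF2.differentiable (by norm_num))
      (hlam2.differentiable (by norm_num))]
    simp [Prod.mk_zero_zero, hF0]
  refine ⟨⟨fun h y => ?_, fun h => ?_⟩, ht, by rw [ht]; exact neg_ne_zero.2 hlam0⟩
  · obtain ⟨w, hw⟩ := h (0, lam 0 • y)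
    rw [fderiv_bigDeltaStar_apply hF2 hlam2 hF0 hFq, Prod.mk.injEq] at hw
    have hτ := (mul_eq_zero.1 hw.1).resolve_left hlam0
    rw [hτ, zero_smul, add_zero] at hw
    exact ⟨_, smul_right_injective _ hlam0 hw.2⟩
  · rintro ⟨s, y⟩
    obtain ⟨v, hv⟩ := h ((lam 0)⁻¹ •
      (y - (s / lam 0) • fun i => fderiv ℝ lam 0 (Pi.single i 1, 0, 0)))
    refine ⟨(v.1, v.2, fderiv ℝ F 0 v - s / lam 0), ?_⟩
    rw [fderiv_bigDeltaStar_apply hF2 hlam2 hF0 hFq, Prod.mk.injEq]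
    simp only [Prod.mk.eta, sub_sub_cancel, hv, smul_inv_smul₀ hlam0, sub_add_cancel, and_true]
    exact mul_div_cancel₀ s hlam0
end

section
/- Let F : ℝ^k×ℝⁿ → ℝ and λ : ℝ^k×ℝⁿ×ℝ → ℝ be C^∞ functions with F(0,0) = 0, ∂F/∂qᵢ(0,0) = 0 for i = 1,…,k, and λ(0,0,0) ≠ 0, and define 𝓕(q,x,t) = λ(q,x,t)·(F(q,x) − t). Then the total derivative at the origin of the map (q,x) ↦ (𝓕(q,x,0), ∂𝓕/∂q₁(q,x,0), …, ∂𝓕/∂q_k(q,x,0)) : ℝ^k×ℝⁿ → ℝ×ℝ^k is surjective if and only if the total derivative at the origin of Δ*F = (F, ∂F/∂q₁, …, ∂F/∂q_k) : ℝ^k×ℝⁿ → ℝ×ℝ^k is surjective; and in that case the total derivative at the origin of ΔF = (∂F/∂q₁, …, ∂F/∂q_k) is also surjective and the vector (∂F/∂x₁(0,0), …, ∂F/∂xₙ(0,0)) is non-zero. -/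
/-- `Δ*F = (F, ∂F/∂q₁, …, ∂F/∂q_k)` for a family `F(q, x)`. -/
noncomputable def smallDeltaStar {k n : ℕ} (F : (Fin k → ℝ) × (Fin n → ℝ) → ℝ) :
    (Fin k → ℝ) × (Fin n → ℝ) → ℝ × (Fin k → ℝ) :=
  fun w => (F w, fun i => fderiv ℝ F w (Pi.single i 1, 0))

section Helpers

variable {k n : ℕ}

lemma HasFDerivAt.mul_of_right_eq_zero {E : Type*} [NormedAddCommGroup E] [NormedSpace ℝ E]
    {u g : E → ℝ} {g' : E →L[ℝ] ℝ} {x : E} (hu : DifferentiableAt ℝ u x)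
    (hg : HasFDerivAt g g' x) (hgx : g x = 0) :
    HasFDerivAt (fun y => u y * g y) (u x • g') x := by
  simpa [hgx] using hu.hasFDerivAt.fun_mul hg

lemma differentiable_fderiv_apply {E : Type*} [NormedAddCommGroup E] [NormedSpace ℝ E]
    {f : E → ℝ} (hf : ContDiff ℝ (⊤ : ℕ∞) f) (v : E) :
    Differentiable ℝ (fun w => fderiv ℝ f w v) :=
  ((hf.fderiv_right (m := (⊤ : ℕ∞)) le_rfl).clm_apply
    contDiff_const).differentiable (by simp)

lemma hasFDerivAt_smallDelta {F : (Fin k → ℝ) × (Fin n → ℝ) → ℝ}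
    (hF : ContDiff ℝ (⊤ : ℕ∞) F) (w : (Fin k → ℝ) × (Fin n → ℝ)) :
    HasFDerivAt (smallDelta F) (ContinuousLinearMap.pi fun i : Fin k =>
      fderiv ℝ (fun w => fderiv ℝ F w (Pi.single i 1, 0)) w) w :=
  hasFDerivAt_pi.2 fun _ => (differentiable_fderiv_apply hF _ w).hasFDerivAt

lemma hasFDerivAt_smallDeltaStar {F : (Fin k → ℝ) × (Fin n → ℝ) → ℝ}
    (hF : ContDiff ℝ (⊤ : ℕ∞) F) (w : (Fin k → ℝ) × (Fin n → ℝ)) :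
    HasFDerivAt (smallDeltaStar F) ((fderiv ℝ F w).prod (fderiv ℝ (smallDelta F) w)) w :=
  (hF.differentiable (by simp) w).hasFDerivAt.prodMk
    (hasFDerivAt_smallDelta hF w).differentiableAt.hasFDerivAt

/-- The `q`-derivatives of `λ(q,x,t)·(F(q,x) − t)` along `t = 0`. -/
lemma fderiv_graphLike_apply {F : (Fin k → ℝ) × (Fin n → ℝ) → ℝ}
    {lam : (Fin k → ℝ) × (Fin n → ℝ) × ℝ → ℝ}
    (hF : Differentiable ℝ F) (hlam : Differentiable ℝ lam)
    (w : (Fin k → ℝ) × (Fin n → ℝ)) (v : Fin k → ℝ) :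
    fderiv ℝ (fun z : (Fin k → ℝ) × (Fin n → ℝ) × ℝ => lam z * (F (z.1, z.2.1) - z.2.2))
        (w.1, w.2, 0) (v, 0, 0) =
      lam (w.1, w.2, 0) * fderiv ℝ F w (v, 0) +
        fderiv ℝ lam (w.1, w.2, 0) (v, 0, 0) * F w := by
  let P : (Fin k → ℝ) × (Fin n → ℝ) × ℝ →L[ℝ] (Fin k → ℝ) × (Fin n → ℝ) :=
    (ContinuousLinearMap.fst ℝ _ _).prod
      ((ContinuousLinearMap.fst ℝ _ _).comp (ContinuousLinearMap.snd ℝ _ _))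
  let T : (Fin k → ℝ) × (Fin n → ℝ) × ℝ →L[ℝ] ℝ :=
    (ContinuousLinearMap.snd ℝ _ _).comp (ContinuousLinearMap.snd ℝ _ _)
  have hFP : HasFDerivAt (fun z : (Fin k → ℝ) × (Fin n → ℝ) × ℝ => F (z.1, z.2.1))
      ((fderiv ℝ F w).comp P) (w.1, w.2, 0) :=
    HasFDerivAt.comp (g := F) (f := P) (w.1, w.2, (0 : ℝ)) (hF w).hasFDerivAt P.hasFDerivAt
  have hT : HasFDerivAt (fun z : (Fin k → ℝ) × (Fin n → ℝ) × ℝ => z.2.2) T (w.1, w.2, 0) :=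
    T.hasFDerivAt
  rw [((hlam _).hasFDerivAt.fun_mul (hFP.fun_sub hT)).fderiv]
  simp [P, T, mul_comm]

lemma fderiv_graphLike_eq {F : (Fin k → ℝ) × (Fin n → ℝ) → ℝ}
    {lam : (Fin k → ℝ) × (Fin n → ℝ) × ℝ → ℝ}
    (hF : ContDiff ℝ (⊤ : ℕ∞) F) (hlam : ContDiff ℝ (⊤ : ℕ∞) lam) (hF0 : F 0 = 0)
    (hFq : ∀ i : Fin k, fderiv ℝ F 0 (Pi.single i 1, 0) = 0)
    {𝓕 : (Fin k → ℝ) × (Fin n → ℝ) × ℝ → ℝ}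
    (h𝓕 : ∀ z, 𝓕 z = lam z * (F (z.1, z.2.1) - z.2.2)) (v : (Fin k → ℝ) × (Fin n → ℝ)) :
    fderiv ℝ (fun qx : (Fin k → ℝ) × (Fin n → ℝ) =>
        ((𝓕 (qx.1, qx.2, 0),
          fun i : Fin k => fderiv ℝ 𝓕 (qx.1, qx.2, 0) (Pi.single i 1, 0, 0))
          : ℝ × (Fin k → ℝ))) 0 v =
      (lam 0 * fderiv ℝ F 0 v, lam 0 • fderiv ℝ (smallDelta F) 0 v +
        fderiv ℝ F 0 v • fun i => fderiv ℝ lam 0 (Pi.single i 1, 0, 0)) := by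
  obtain rfl : 𝓕 = fun z => lam z * (F (z.1, z.2.1) - z.2.2) := funext h𝓕
  have dF : Differentiable ℝ F := hF.differentiable (by simp)
  have dlam : Differentiable ℝ lam := hlam.differentiable (by simp)
  simp only [fderiv_graphLike_apply dF dlam, sub_zero, Prod.mk.eta]
  have dι : DifferentiableAt ℝ
      (fun w : (Fin k → ℝ) × (Fin n → ℝ) => (w.1, w.2, (0 : ℝ))) 0 := by fun_prop
  have dl : DifferentiableAt ℝ
      (fun w : (Fin k → ℝ) × (Fin n → ℝ) => lam (w.1, w.2, 0)) 0 :=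
    DifferentiableAt.comp (g := lam) 0 (dlam _) dι
  have h₁ := HasFDerivAt.mul_of_right_eq_zero dl (dF 0).hasFDerivAt hF0
  have dm (i : Fin k) : DifferentiableAt ℝ (fun w : (Fin k → ℝ) × (Fin n → ℝ) =>
      fderiv ℝ lam (w.1, w.2, 0) (Pi.single i 1, 0, 0)) 0 :=
    DifferentiableAt.comp (g := fun z => fderiv ℝ lam z (Pi.single i 1, 0, 0)) 0
      (differentiable_fderiv_apply hlam _ _) dι
  have h₂ := fun i : Fin k =>
    (HasFDerivAt.mul_of_right_eq_zero dl
      (differentiable_fderiv_apply hF (Pi.single i 1, 0) 0).hasFDerivAt (hFq i)).fun_add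
    (HasFDerivAt.mul_of_right_eq_zero (dm i) (dF 0).hasFDerivAt hF0)
  rw [(h₁.prodMk (hasFDerivAt_pi.2 h₂)).fderiv, (hasFDerivAt_smallDelta hF 0).fderiv]
  ext i
  · simp [← Prod.zero_eq_mk]
  · simp [← Prod.zero_eq_mk, mul_comm]

/-- A linear form on `ℝ^k × ℝⁿ` vanishing on all standard basis vectors is zero. -/
lemma eq_zero_of_apply_single {A : (Fin k → ℝ) × (Fin n → ℝ) →L[ℝ] ℝ}
    (h₁ : ∀ i, A (Pi.single i 1, 0) = 0) (h₂ : ∀ j, A (0, Pi.single j 1) = 0) : A = 0 := by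
  apply ContinuousLinearMap.coe_injective
  ext i
  · simpa using h₁ i
  · simpa using h₂ i

end Helpers

/-- Proposition 4.5: for `𝓕(q,x,t) = λ(q,x,t)·(F(q,x) − t)` with `λ(0) ≠ 0`,
`F(0,0) = 0` and `∂F/∂qᵢ(0,0) = 0`, the derivative at the origin of
`(q,x) ↦ (𝓕(q,x,0), ∂𝓕/∂q₁(q,x,0), …, ∂𝓕/∂q_k(q,x,0))` is surjective iff the
derivative at the origin of `Δ*F` is surjective (i.e. `𝓕` is non-degenerate iff
`F` is a Morse family of hypersurfaces); in that case the derivative at the origin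
of `ΔF` is also surjective and `(∂F/∂x₁(0), …, ∂F/∂xₙ(0)) ≠ 0`. -/
theorem stmt_5 {k n : ℕ} (F : (Fin k → ℝ) × (Fin n → ℝ) → ℝ)
    (lam : (Fin k → ℝ) × (Fin n → ℝ) × ℝ → ℝ)
    (hF : ContDiff ℝ (⊤ : ℕ∞) F) (hlam : ContDiff ℝ (⊤ : ℕ∞) lam)
    (hF0 : F 0 = 0)
    (hFq : ∀ i : Fin k, fderiv ℝ F 0 (Pi.single i 1, 0) = 0)
    (hlam0 : lam 0 ≠ 0)
    (𝓕 : (Fin k → ℝ) × (Fin n → ℝ) × ℝ → ℝ)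
    (h𝓕 : ∀ z, 𝓕 z = lam z * (F (z.1, z.2.1) - z.2.2)) :
    ((Function.Surjective ⇑(fderiv ℝ (fun qx : (Fin k → ℝ) × (Fin n → ℝ) =>
          ((𝓕 (qx.1, qx.2, 0),
            fun i : Fin k => fderiv ℝ 𝓕 (qx.1, qx.2, 0) (Pi.single i 1, 0, 0))
            : ℝ × (Fin k → ℝ))) 0)
        ↔ Function.Surjective ⇑(fderiv ℝ (smallDeltaStar F) 0)) ∧
      (Function.Surjective ⇑(fderiv ℝ (smallDeltaStar F) 0) →
        Function.Surjective ⇑(fderiv ℝ (smallDelta F) 0) ∧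
        (fun j : Fin n => fderiv ℝ F 0 (0, Pi.single j 1)) ≠ 0)) := by
  rw [(hasFDerivAt_smallDeltaStar hF 0).fderiv]
  have key := fderiv_graphLike_eq hF hlam hF0 hFq h𝓕
  refine ⟨⟨fun h => ?_, fun h => ?_⟩, fun h => ⟨?_, fun h0 => ?_⟩⟩
  · rintro ⟨a, b⟩
    obtain ⟨v, hv⟩ := h (lam 0 * a, lam 0 • b + a • fun i => fderiv ℝ lam 0 (Pi.single i 1, 0, 0))
    rw [key, Prod.mk.injEq] at hv
    have ha : fderiv ℝ F 0 v = a := mul_left_cancel₀ hlam0 hv.1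
    have hb : fderiv ℝ (smallDelta F) 0 v = b := by
      have := hv.2
      rw [ha] at this
      exact smul_right_injective _ hlam0 (add_right_cancel this)
    exact ⟨v, Prod.ext ha hb⟩
  · rintro ⟨a, b⟩
    obtain ⟨v, hv⟩ := h ((lam 0)⁻¹ * a, (lam 0)⁻¹ •
      (b - ((lam 0)⁻¹ * a) • fun i => fderiv ℝ lam 0 (Pi.single i 1, 0, 0)))
    rw [ContinuousLinearMap.prod_apply, Prod.mk.injEq] at hv
    refine ⟨v, ?_⟩
    rw [key, hv.1, hv.2, smul_inv_smul₀ hlam0, mul_inv_cancel_left₀ hlam0, sub_add_cancel]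
  · intro b
    obtain ⟨v, hv⟩ := h (0, b)
    exact ⟨v, congrArg Prod.snd hv⟩
  · obtain ⟨v, hv⟩ := h (1, 0)
    have hv₁ : fderiv ℝ F 0 v = 1 := congrArg Prod.fst hv
    rw [eq_zero_of_apply_single hFq fun j => congrFun h0 j] at hv₁
    simp at hv₁
end

section
/- Let f, g : ℝ^k → ℝ be C^∞ functions with f(0) = g(0) = 0. Suppose there exist a C^∞ map φ : ℝ^k×ℝ → ℝ^k with φ(0,0) = 0 such that the map Φ(q,t) = (φ(q,t), t) is a local diffeomorphism of ℝ^k×ℝ at the origin, and a C^∞ function λ : ℝ^k×ℝ → ℝ with λ(0,0) ≠ 0, such that f(q) − t = λ(q,t)·(g(φ(q,t)) − t) for all (q,t) in some neighbourhood of the origin. Then the map ψ : ℝ^k → ℝ^k defined by ψ(q) = φ(q, f(q)) satisfies ψ(0) = 0, is a local diffeomorphism of ℝ^k at the origin, and f(q) = g(ψ(q)) for all q in some neighbourhood of 0. -/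
open Filter

/-- Lemma 4.11: if `f̄(q,t) = f(q) − t` and `ḡ(q,t) = g(q) − t` are S.P-𝒦-equivalent,
i.e. `f(q) − t = λ(q,t)·(g(φ(q,t)) − t)` near the origin for a diffeomorphism germ
`Φ(q,t) = (φ(q,t), t)` (expressed by `Φ` being smooth with bijective derivative at
the origin, hence a local diffeomorphism) and a unit `λ`, then `ψ(q) = φ(q, f(q))`
is a diffeomorphism germ of `(ℝ^k, 0)` realizing the 𝓡-equivalence `f = g ∘ ψ`. -/
theorem stmt_7 {k : ℕ} (f g : (Fin k → ℝ) → ℝ)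
    (hf : ContDiff ℝ (⊤ : ℕ∞) f) (hg : ContDiff ℝ (⊤ : ℕ∞) g)
    (hf0 : f 0 = 0) (hg0 : g 0 = 0)
    (φ : (Fin k → ℝ) × ℝ → (Fin k → ℝ)) (hφ : ContDiff ℝ (⊤ : ℕ∞) φ)
    (hφ0 : φ 0 = 0)
    (hΦ : Function.Bijective
      ⇑(fderiv ℝ (fun z : (Fin k → ℝ) × ℝ => ((φ z, z.2) : (Fin k → ℝ) × ℝ)) 0))
    (lam : (Fin k → ℝ) × ℝ → ℝ) (hlam : ContDiff ℝ (⊤ : ℕ∞) lam)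
    (hlam0 : lam 0 ≠ 0)
    (heq : ∀ᶠ z : (Fin k → ℝ) × ℝ in nhds 0, f z.1 - z.2 = lam z * (g (φ z) - z.2)) :
    (fun q => φ (q, f q)) 0 = 0 ∧
    Function.Bijective ⇑(fderiv ℝ (fun q => φ (q, f q)) 0) ∧
    ∀ᶠ q : Fin k → ℝ in nhds 0, f q = g (φ (q, f q)) := by
  have hz : ((0 : Fin k → ℝ), f 0) = 0 := by rw [hf0]; rfl
  have hcont : Filter.Tendsto (fun q => (q, f q)) (nhds 0) (nhds 0) := by
    have h : ContinuousAt (fun q => (q, f q)) 0 := (continuous_id.prodMk hf.continuous).continuousAt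
    rwa [ContinuousAt, hz] at h
  have hψ0 : φ (0, f 0) = 0 := by rw [hz, hφ0]
  have hfg : ∀ᶠ q : Fin k → ℝ in nhds 0, f q = g (φ (q, f q)) := by
    filter_upwards [hcont.eventually heq,
      hcont.eventually (hlam.continuous.continuousAt.eventually_ne hlam0)] with q hq hne
    have hprod : lam (q, f q) * (g (φ (q, f q)) - f q) = 0 := by rw [← hq, sub_self]
    exact (sub_eq_zero.mp ((mul_eq_zero.mp hprod).resolve_left hne)).symm
  refine ⟨hψ0, ?_, hfg⟩
  have hdf : HasFDerivAt f (fderiv ℝ f 0) 0 := (hf.differentiable (by simp) 0).hasFDerivAt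
  have hdg : HasFDerivAt g (fderiv ℝ g 0) (φ (0, f 0)) := by
    rw [hψ0]
    exact (hg.differentiable (by simp) 0).hasFDerivAt
  have hdφ : HasFDerivAt φ (fderiv ℝ φ 0) 0 := (hφ.differentiable (by simp) 0).hasFDerivAt
  have hdψ : HasFDerivAt (fun q => φ (q, f q))
      ((fderiv ℝ φ 0).comp ((ContinuousLinearMap.id ℝ _).prod (fderiv ℝ f 0))) 0 :=
    HasFDerivAt.comp (g := φ) 0 (hz.symm ▸ hdφ) ((hasFDerivAt_id 0).prodMk hdf)
  have hdΦ := hdφ.prodMk (hasFDerivAt_snd (𝕜 := ℝ) (p := (0 : (Fin k → ℝ) × ℝ)))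
  have hdfg := hdf.unique ((hdg.comp 0 hdψ).congr_of_eventuallyEq hfg)
  rw [hdΦ.fderiv] at hΦ
  rw [hdψ.fderiv]
  set L := (fderiv ℝ φ 0).comp ((ContinuousLinearMap.id ℝ _).prod (fderiv ℝ f 0)) with hL
  have hinj : Function.Injective L := by
    refine (injective_iff_map_eq_zero L).mpr fun v hv => ?_
    have hfv : fderiv ℝ f 0 v = 0 := by
      rw [hdfg, ContinuousLinearMap.comp_apply, hv, map_zero]
    have hφv : fderiv ℝ φ 0 (v, 0) = 0 := by simpa [hL, hfv] using hv
    have hker : ((v, 0) : (Fin k → ℝ) × ℝ) = 0 := hΦ.injective (by simp [hφv])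
    exact congrArg Prod.fst hker
  exact ⟨hinj, LinearMap.injective_iff_surjective (f := L.toLinearMap).mp hinj⟩
end

section
/- Let f, g, h : ℝ^k → ℝ and λ₁, …, λ_k, μ : ℝ^k×ℝ → ℝ be C^∞ functions and let c ∈ ℝ, and suppose that g(q) = Σᵢ₌₁^k λᵢ(q,t)·(∂f/∂qᵢ)(q) + μ(q,t)·(f(q) − t) + c + h(q) for all (q,t) ∈ ℝ^k×ℝ. Then for every natural number ℓ there exist C^∞ functions γ₁, …, γ_k : ℝ^k → ℝ such that g(q) = Σᵢ₌₁^k γᵢ(q)·(∂f/∂qᵢ)(q) + (1/ℓ!)·(∂^ℓμ/∂t^ℓ)(q,0)·f(q)^{ℓ+1} + c + h(q) for all q ∈ ℝ^k. -/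
open scoped ContDiff in
/-- Iterated partial derivatives of a smooth function with respect to the last variable are
smooth in all variables. -/
theorem ContDiff.iteratedDeriv_prodMk_right {E : Type*} [NormedAddCommGroup E] [NormedSpace ℝ E]
    {F : E × ℝ → ℝ} (hF : ContDiff ℝ ∞ F) (n : ℕ) :
    ContDiff ℝ ∞ (fun p : E × ℝ => iteratedDeriv n (fun s => F (p.1, s)) p.2) := by
  induction n with
  | zero => simpa using hF
  | succ n ih =>
    have hderiv : (fun p : E × ℝ => iteratedDeriv (n + 1) (fun s => F (p.1, s)) p.2) =
        fun p => fderiv ℝ (fun p : E × ℝ => iteratedDeriv n (fun s => F (p.1, s)) p.2) p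
          ((0 : E), (1 : ℝ)) := by
      funext ⟨q, t⟩
      rw [iteratedDeriv_succ]
      have hcurve : HasDerivAt (fun s : ℝ => (q, s)) ((0 : E), (1 : ℝ)) t :=
        (hasDerivAt_const t q).prodMk (hasDerivAt_id t)
      exact ((ih.differentiable (by simp) (q, t)).hasFDerivAt.comp_hasDerivAt t hcurve).deriv
    rw [hderiv]
    exact (ih.fderiv_right (m := ∞) (by simp)).clm_apply contDiff_const

open scoped ContDiff in
/-- Leibniz's rule for the iterated derivatives of a constant function of the form
`Σᵢ aᵢ(t) dᵢ + b(t) (x - t)`. -/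
theorem sum_iteratedDeriv_mul_add_iteratedDeriv_mul_sub {ι : Type*} [Fintype ι]
    {a : ι → ℝ → ℝ} {b : ℝ → ℝ} (d : ι → ℝ) (x C : ℝ)
    (ha : ∀ i, ContDiff ℝ ∞ (a i)) (hb : ContDiff ℝ ∞ b)
    (h : ∀ t, ∑ i, a i t * d i + b t * (x - t) = C) (n : ℕ) (t : ℝ) :
    ∑ i, iteratedDeriv (n + 1) (a i) t * d i + iteratedDeriv (n + 1) b t * (x - t) =
      (n + 1) * iteratedDeriv n b t := by
  have hderiv {u : ℝ → ℝ} (hu : ContDiff ℝ ∞ u) (m : ℕ) (t : ℝ) :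
      HasDerivAt (iteratedDeriv m u) (iteratedDeriv (m + 1) u t) t := by
    rw [iteratedDeriv_succ]
    exact (hu.differentiable_iteratedDeriv m (by exact_mod_cast WithTop.coe_lt_top m) t).hasDerivAt
  have hlhs (m : ℕ) (t : ℝ) :
      HasDerivAt (fun t => ∑ i, iteratedDeriv m (a i) t * d i + iteratedDeriv m b t * (x - t))
        (∑ i, iteratedDeriv (m + 1) (a i) t * d i +
          (iteratedDeriv (m + 1) b t * (x - t) + iteratedDeriv m b t * (-1))) t :=
    (HasDerivAt.fun_sum fun i _ => (hderiv (ha i) m t).mul_const (d i)).add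
      ((hderiv hb m t).mul ((hasDerivAt_id t).const_sub x))
  induction n generalizing t with
  | zero =>
    have h0 := hlhs 0 t
    simp only [iteratedDeriv_zero, h] at h0
    have := h0.unique (hasDerivAt_const t C)
    simp only [iteratedDeriv_zero, Nat.cast_zero]
    linarith
  | succ n ih =>
    have h1 := hlhs (n + 1) t
    simp only [ih] at h1
    have := h1.unique ((hderiv hb n t).const_mul ((n : ℝ) + 1))
    push_cast
    linarith

/-- The key computation in the proof of Theorem 4.13: if
`g(q) = Σᵢ λᵢ(q,t)·∂f/∂qᵢ(q) + μ(q,t)·(f(q) − t) + c + h(q)` for all `(q,t)`, then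
for every `ℓ` there are smooth `γᵢ` with
`g(q) = Σᵢ γᵢ(q)·∂f/∂qᵢ(q) + (1/ℓ!)·(∂^ℓμ/∂t^ℓ)(q,0)·f(q)^{ℓ+1} + c + h(q)`. -/
theorem stmt_8 {k : ℕ} (f g h : (Fin k → ℝ) → ℝ)
    (lam : Fin k → ((Fin k → ℝ) × ℝ) → ℝ) (μ : ((Fin k → ℝ) × ℝ) → ℝ) (c : ℝ)
    (hf : ContDiff ℝ (⊤ : ℕ∞) f) (hg : ContDiff ℝ (⊤ : ℕ∞) g)
    (hh : ContDiff ℝ (⊤ : ℕ∞) h)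
    (hlam : ∀ i, ContDiff ℝ (⊤ : ℕ∞) (lam i)) (hμ : ContDiff ℝ (⊤ : ℕ∞) μ)
    (heq : ∀ q t, g q = ∑ i, lam i (q, t) * fderiv ℝ f q (Pi.single i 1)
        + μ (q, t) * (f q - t) + c + h q) :
    ∀ ℓ : ℕ, ∃ γ : Fin k → (Fin k → ℝ) → ℝ,
      (∀ i, ContDiff ℝ (⊤ : ℕ∞) (γ i)) ∧
      ∀ q, g q = ∑ i, γ i q * fderiv ℝ f q (Pi.single i 1)
        + (1 / (Nat.factorial ℓ) : ℝ) * iteratedDeriv ℓ (fun s => μ (q, s)) 0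
            * (f q) ^ (ℓ + 1)
        + c + h q := by
  have hslice {F : (Fin k → ℝ) × ℝ → ℝ} (hF : ContDiff ℝ (⊤ : ℕ∞) F) (n : ℕ) :
      ContDiff ℝ (⊤ : ℕ∞) (fun q => iteratedDeriv n (fun s => F (q, s)) 0) :=
    (hF.iteratedDeriv_prodMk_right n).comp (contDiff_id.prodMk contDiff_const)
  intro ℓ
  induction ℓ with
  | zero =>
    refine ⟨fun i q => lam i (q, 0), fun i => by simpa using hslice (hlam i) 0, fun q => ?_⟩
    simpa using heq q 0
  | succ n ih =>
    obtain ⟨γ, hγ, hg_eq⟩ := ih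
    refine ⟨fun i q => γ i q + 1 / ((n + 1).factorial : ℝ) * f q ^ (n + 1) *
        iteratedDeriv (n + 1) (fun s => lam i (q, s)) 0,
      fun i => (hγ i).add ((contDiff_const.mul (hf.pow _)).mul (hslice (hlam i) _)), fun q => ?_⟩
    have hrec := sum_iteratedDeriv_mul_add_iteratedDeriv_mul_sub
      (a := fun i s => lam i (q, s)) (b := fun s => μ (q, s))
      (fun i => fderiv ℝ f q (Pi.single i 1)) (f q) (g q - c - h q)
      (fun i => (hlam i).comp (contDiff_const.prodMk contDiff_id))
      (hμ.comp (contDiff_const.prodMk contDiff_id))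
      (fun t => by linarith [heq q t]) n 0
    have hfac : (1 / (n.factorial : ℝ)) = 1 / ((n + 1).factorial : ℝ) * (n + 1) := by
      rw [Nat.factorial_succ]
      push_cast
      field_simp
    rw [hg_eq q, hfac]
    simp only [add_mul, Finset.sum_add_distrib, mul_assoc _ (iteratedDeriv _ _ _),
      ← Finset.mul_sum]
    linear_combination (-(1 / ((n + 1).factorial : ℝ) * f q ^ (n + 1))) * hrec
end

section
/- Let n ≥ 2, U ⊆ ℝ^{n−1} open, X : U → ℝⁿ a C^∞ immersion with C^∞ unit normal field 𝐧 : U → ℝⁿ. Fix u ∈ U and v ∈ ℝⁿ, and let d_v(u') = ‖X(u') − v‖². Then the derivative of d_v at u is zero if and only if there exists r ∈ ℝ such that v = X(u) + r·𝐧(u); moreover, if v ≠ X(u), then any such r is non-zero. -/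
open RealInnerProductSpace

/-- A nonzero vector orthogonal to the range of an injective linear map of corank one spans the
orthogonal complement of that range. -/
theorem LinearMap.orthogonal_range_eq_span_singleton {E F : Type*} [AddCommGroup E] [Module ℝ E]
    [NormedAddCommGroup F] [InnerProductSpace ℝ F] [FiniteDimensional ℝ F]
    (T : E →ₗ[ℝ] F) (hT : Function.Injective T)
    (hdim : Module.finrank ℝ F = Module.finrank ℝ E + 1)
    {ν : F} (hν : ν ≠ 0) (hperp : ∀ w, ⟪ν, T w⟫ = 0) :
    (LinearMap.range T)ᗮ = Submodule.span ℝ {ν} := by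
  symm
  apply Submodule.eq_of_le_of_finrank_eq
  · rw [Submodule.span_singleton_le_iff_mem, Submodule.mem_orthogonal']
    rintro _ ⟨w, rfl⟩
    exact hperp w
  · have h := Submodule.finrank_add_finrank_orthogonal (LinearMap.range T)
    rw [LinearMap.finrank_range_of_inj hT] at h
    rw [finrank_span_singleton hν]
    lia

/-- The distance squared function from `v` is critical at `u` iff `f u - v` is orthogonal to the
range of the derivative of `f` at `u`. -/
theorem fderiv_norm_sub_const_sq_eq_zero_iff {E F : Type*} [NormedAddCommGroup E]
    [NormedSpace ℝ E] [NormedAddCommGroup F] [InnerProductSpace ℝ F] {f : E → F} {u : E}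
    (hf : DifferentiableAt ℝ f u) (v : F) :
    fderiv ℝ (fun x => ‖f x - v‖ ^ 2) u = 0 ↔
      f u - v ∈ (LinearMap.range (fderiv ℝ f u).toLinearMap)ᗮ := by
  rw [(hf.hasFDerivAt.sub_const v).norm_sq.fderiv, Submodule.mem_orthogonal']
  simp [ContinuousLinearMap.ext_iff, inner_sub_left]

/-- Proposition 5.6 (1): for a hypersurface `X : U → ℝⁿ` with unit normal `𝐧`, the
derivative of the distance squared function `d_v(u') = ‖X(u') − v‖²` at `u` vanishes
iff `v = X(u) + r·𝐧(u)` for some `r ∈ ℝ`; if moreover `v ≠ X(u)` then any such `r`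
is non-zero. -/
theorem stmt_9 {n : ℕ} (hn : 2 ≤ n)
    (U : Set (EuclideanSpace ℝ (Fin (n - 1)))) (hU : IsOpen U)
    (X nor : EuclideanSpace ℝ (Fin (n - 1)) → EuclideanSpace ℝ (Fin n))
    (hX : ContDiffOn ℝ (⊤ : ℕ∞) X U)
    (himm : ∀ u ∈ U, Function.Injective ⇑(fderiv ℝ X u))
    (hnor : ContDiffOn ℝ (⊤ : ℕ∞) nor U)
    (hunit : ∀ u ∈ U, ‖nor u‖ = 1)
    (hperp : ∀ u ∈ U, ∀ w, ⟪nor u, fderiv ℝ X u w⟫ = 0)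
    (u : EuclideanSpace ℝ (Fin (n - 1))) (hu : u ∈ U)
    (v : EuclideanSpace ℝ (Fin n)) :
    (fderiv ℝ (fun u' => ‖X u' - v‖ ^ 2) u = 0 ↔ ∃ r : ℝ, v = X u + r • nor u) ∧
    (v ≠ X u → ∀ r : ℝ, v = X u + r • nor u → r ≠ 0) := by
  have hdiff : DifferentiableAt ℝ X u :=
    (hX.contDiffAt (hU.mem_nhds hu)).differentiableAt (by simp)
  have hν : nor u ≠ 0 := norm_ne_zero_iff.mp (by simp [hunit u hu])
  refine ⟨?_, ?_⟩
  · rw [fderiv_norm_sub_const_sq_eq_zero_iff hdiff,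
      LinearMap.orthogonal_range_eq_span_singleton (fderiv ℝ X u).toLinearMap (himm u hu)
        (by simp only [finrank_euclideanSpace_fin]; lia) hν (hperp u hu),
      ← neg_mem_iff, neg_sub, Submodule.mem_span_singleton]
    simp only [eq_sub_iff_add_eq', eq_comm]
  · rintro hne r hr rfl
    exact hne (by simpa using hr)
end

section
/- Let n ≥ 2, U ⊆ ℝ^{n−1} open, X : U → ℝⁿ a C^∞ immersion with C^∞ unit normal field 𝐧 : U → ℝⁿ. Fix u ∈ U and r ∈ ℝ with r ≠ 0, and let v = X(u) + r·𝐧(u) and d_v(u') = ‖X(u') − v‖². Then the Hessian matrix of d_v at u has entries (∂²d_v/∂uᵢ∂uⱼ)(u) = 2·(gᵢⱼ(u) − r·hᵢⱼ(u)), where gᵢⱼ(u) = ⟨(∂X/∂uᵢ)(u), (∂X/∂uⱼ)(u)⟩ and hᵢⱼ(u) = ⟨(∂²X/∂uᵢ∂uⱼ)(u), 𝐧(u)⟩. Consequently, the derivative of d_v at u vanishes and det 𝓗(d_v)(u) = 0 if and only if det(h(u) − (1/r)·g(u)) = 0, i.e. 1/r is a principal curvature of the hypersurface at u. -/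
open RealInnerProductSpace

section DistanceSquared

variable {E F : Type*} [NormedAddCommGroup E] [NormedSpace ℝ E]
  [NormedAddCommGroup F] [InnerProductSpace ℝ F]

theorem fderiv_norm_sub_sq_apply {X : E → F} {x : E} (hX : DifferentiableAt ℝ X x) (v : F)
    (w : E) :
    fderiv ℝ (fun y => ‖X y - v‖ ^ 2) x w = 2 * inner ℝ (X x - v) (fderiv ℝ X x w) := by
  have h := (hX.hasFDerivAt.sub_const v).norm_sq
  rw [h.fderiv]
  simp [inner_sub_left]

theorem fderiv_fderiv_norm_sub_sq_apply {X : E → F} {x : E} (hX : ContDiffAt ℝ 2 X x) (v : F)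
    (w z : E) :
    fderiv ℝ (fun y => fderiv ℝ (fun y' => ‖X y' - v‖ ^ 2) y z) x w =
      2 * (inner ℝ (fderiv ℝ X x w) (fderiv ℝ X x z) +
        inner ℝ (X x - v) (fderiv ℝ (fun y => fderiv ℝ X y z) x w)) := by
  have hev : (fun y => fderiv ℝ (fun y' => ‖X y' - v‖ ^ 2) y z) =ᶠ[nhds x]
      fun y => 2 * inner ℝ (X y - v) (fderiv ℝ X y z) := by
    filter_upwards [hX.eventually (by simp)] with y hy
    exact fderiv_norm_sub_sq_apply (hy.differentiableAt (by simp)) v z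
  have hd : DifferentiableAt ℝ X x := hX.differentiableAt (by simp)
  have hd' : DifferentiableAt ℝ (fun y => fderiv ℝ X y z) x :=
    ((hX.fderiv_right (m := 1) (by norm_num)).differentiableAt (by simp)).clm_apply
      (differentiableAt_const z)
  rw [hev.fderiv_eq, fderiv_const_mul ((hd.sub_const v).inner ℝ hd')]
  simp only [smul_apply, smul_eq_mul]
  rw [fderiv_inner_apply ℝ (hd.sub_const v) hd', fderiv_sub_const]
  ring

end DistanceSquared

/-- Proposition 5.6 (2): for a hypersurface `X : U → ℝⁿ` with unit normal `𝐧` and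
`v = X(u) + r·𝐧(u)` with `r ≠ 0`, the Hessian of the distance squared function
`d_v(u') = ‖X(u') − v‖²` at `u` has entries `2·(gᵢⱼ − r·hᵢⱼ)` (first and second
fundamental forms); consequently the derivative of `d_v` at `u` vanishes, and
`det 𝓗(d_v)(u) = 0` iff `det(h − (1/r)·g) = 0`, i.e. `1/r` is a principal
curvature at `u`. -/
theorem stmt_10 {n : ℕ} (hn : 2 ≤ n)
    (U : Set (EuclideanSpace ℝ (Fin (n - 1)))) (hU : IsOpen U)
    (X nor : EuclideanSpace ℝ (Fin (n - 1)) → EuclideanSpace ℝ (Fin n))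
    (hX : ContDiffOn ℝ (⊤ : ℕ∞) X U)
    (himm : ∀ u ∈ U, Function.Injective ⇑(fderiv ℝ X u))
    (hnor : ContDiffOn ℝ (⊤ : ℕ∞) nor U)
    (hunit : ∀ u ∈ U, ‖nor u‖ = 1)
    (hperp : ∀ u ∈ U, ∀ w, ⟪nor u, fderiv ℝ X u w⟫ = 0)
    (u : EuclideanSpace ℝ (Fin (n - 1))) (hu : u ∈ U)
    (r : ℝ) (hr : r ≠ 0) (v : EuclideanSpace ℝ (Fin n))
    (hv : v = X u + r • nor u)
    (g h : Matrix (Fin (n - 1)) (Fin (n - 1)) ℝ)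
    (hg : ∀ i j, g i j = ⟪fderiv ℝ X u (EuclideanSpace.single i 1),
        fderiv ℝ X u (EuclideanSpace.single j 1)⟫)
    (hh : ∀ i j, h i j = ⟪fderiv ℝ (fun u' =>
        fderiv ℝ X u' (EuclideanSpace.single j 1)) u (EuclideanSpace.single i 1), nor u⟫)
    (H : Matrix (Fin (n - 1)) (Fin (n - 1)) ℝ)
    (hH : ∀ i j, H i j = fderiv ℝ (fun u' =>
        fderiv ℝ (fun u'' => ‖X u'' - v‖ ^ 2) u' (EuclideanSpace.single j 1)) u
        (EuclideanSpace.single i 1)) :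
    (∀ i j, H i j = 2 * (g i j - r * h i j)) ∧
    fderiv ℝ (fun u' => ‖X u' - v‖ ^ 2) u = 0 ∧
    (H.det = 0 ↔ (Matrix.of fun i j => h i j - (1 / r) * g i j).det = 0) := by
  have hX2 : ContDiffAt ℝ 2 X u :=
    (hX.contDiffAt (hU.mem_nhds hu)).of_le (WithTop.coe_le_coe.2 le_top)
  have hXv : X u - v = -(r • nor u) := by rw [hv]; abel
  have hH' : ∀ i j, H i j = 2 * (g i j - r * h i j) := fun i j => by
    rw [hH, fderiv_fderiv_norm_sub_sq_apply hX2, hg, hh, hXv, inner_neg_left,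
      real_inner_smul_left, real_inner_comm (nor u), sub_eq_add_neg]
  refine ⟨hH', ?_, ?_⟩
  · ext w
    rw [fderiv_norm_sub_sq_apply (hX2.differentiableAt (by simp)), hXv, inner_neg_left,
      real_inner_smul_left, hperp u hu]
    simp
  · have hHsmul : H = (-2 * r) • Matrix.of fun i j => h i j - (1 / r) * g i j := by
      ext i j
      rw [hH', Matrix.smul_apply, Matrix.of_apply, smul_eq_mul]
      field_simp
      ring
    rw [hHsmul, Matrix.det_smul, mul_eq_zero, or_iff_right]
    exact pow_ne_zero _ (mul_ne_zero (by norm_num) hr)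
end
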